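/- The λ-open topology τ_λ makes C(X,ℝ^ι) a topological algebra over ℝ (i.e., a topological vector space over ℝ in which the pointwise multiplication (f,g) ↦ f·g is also jointly continuous) if and only if every member of λ is C_ι-compact in X and λ = λ(C_ι). -/

import Mathlib

open Topology Set

/-- The λ-open (set-open) topology on `C(X, ι → ℝ)` generated by the subbasis
`[A, U] = {f | f(A) ⊆ U}` for `A ∈ Λ` and `U` open in `ι → ℝ`. -/
def setOpenTopology {X : Type*} [TopologicalSpace X] (ι : Type*) (Λ : Set (Set X)) :
    TopologicalSpace C(X, ι → ℝ) :=
  TopologicalSpace.generateFrom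
    {S | ∃ A ∈ Λ, ∃ U : Set (ι → ℝ), IsOpen U ∧ S = {f : C(X, ι → ℝ) | Set.MapsTo f A U}}

/-- A subset `B ⊆ X` is `C_ι`-compact in `X` if `f(B)` is compact in `ℝ^ι`
for every continuous `f : X → ℝ^ι`. -/
def CCompactIn {X : Type*} [TopologicalSpace X] (ι : Type*) (B : Set X) : Prop :=
  ∀ f : C(X, ι → ℝ), IsCompact (⇑f '' B)

/-- The family `λ(C_ι)`. -/
def lambdaC {X : Type*} [TopologicalSpace X] (ι : Type*) (Λ : Set (Set X)) : Set (Set X) :=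
  {A | A ∈ Λ ∧ ∀ B ⊆ A, CCompactIn ι B → ∀ U : Set (ι → ℝ), IsOpen U →
    IsOpen[setOpenTopology ι Λ] {f : C(X, ι → ℝ) | Set.MapsTo f B U}}

section

open Filter Uniformity

variable {X ι : Type*} [TopologicalSpace X] {Λ : Set (Set X)} {A B : Set X}

theorem isOpen_setOpenTopology (hA : A ∈ Λ) {U : Set (ι → ℝ)} (hU : IsOpen U) :
    IsOpen[setOpenTopology ι Λ] {f : C(X, ι → ℝ) | MapsTo f A U} :=
  TopologicalSpace.isOpen_generateFrom_of_mem ⟨A, hA, U, hU, rfl⟩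

theorem continuous_const_setOpenTopology (hΛ : ∀ A ∈ Λ, A.Nonempty) :
    Continuous[inferInstance, setOpenTopology ι Λ]
      (fun c : ι → ℝ => ContinuousMap.const X c) := by
  refine continuous_generateFrom_iff.2 ?_
  rintro _ ⟨A, hA, U, hU, rfl⟩
  convert hU using 1
  ext c
  obtain ⟨x, hx⟩ := hΛ A hA
  exact ⟨fun h => h hx, fun h _ _ => h⟩

/-! ### Images of `C_ι`-compact sets -/

theorem isCompact_image_of_real {Y : Type*} [PseudoMetricSpace Y] [ProperSpace Y] [T2Space Y]
    (hA : ∀ h : C(X, ℝ), IsCompact (h '' A)) (F : C(X, Y)) : IsCompact (F '' A) := by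
  have hdist (y : Y) : IsCompact ((fun x => dist (F x) y) '' A) :=
    hA ⟨fun x => dist (F x) y, by fun_prop⟩
  refine Metric.isCompact_of_isClosed_isBounded (isClosed_of_closure_subset fun p hp => ?_) ?_
  · have h0 : (0 : ℝ) ∈ (fun x => dist (F x) p) '' A := by
      rw [← (hdist p).isClosed.closure_eq, Metric.mem_closure_iff]
      intro ε hε
      obtain ⟨_, ⟨x, hx, rfl⟩, hxε⟩ := Metric.mem_closure_iff.1 hp ε hε
      refine ⟨_, ⟨x, hx, rfl⟩, ?_⟩
      simpa [Real.dist_eq, dist_comm] using hxε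
    obtain ⟨x, hx, hx0⟩ := h0
    refine ⟨x, hx, ?_⟩
    exact (Metric.inseparable_iff.2 hx0).eq
  · obtain rfl | ⟨x₀, -⟩ := A.eq_empty_or_nonempty
    · simp
    obtain ⟨r, hr⟩ := (hdist (F x₀)).bddAbove
    refine (Metric.isBounded_closedBall (x := F x₀) (r := r)).subset ?_
    rintro _ ⟨x, hx, rfl⟩
    exact hr ⟨x, hx, rfl⟩

theorem CCompactIn.isCompact_image_real [Nonempty ι] (hA : CCompactIn ι A) (h : C(X, ℝ)) :
    IsCompact (h '' A) := by
  obtain ⟨i⟩ := ‹Nonempty ι›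
  have := (hA ⟨fun x _ => h x, by fun_prop⟩).image (continuous_apply i)
  rwa [image_image] at this

theorem CCompactIn.isCompact_image_prod [Nonempty ι] (hA : CCompactIn ι A)
    (f g : C(X, ι → ℝ)) : IsCompact ((fun x => (f x, g x)) '' A) := by
  cases finite_or_infinite ι
  · have := Fintype.ofFinite ι
    exact isCompact_image_of_real hA.isCompact_image_real (f.prodMk g)
  · obtain ⟨e⟩ : Nonempty (ι ⊕ ι ≃ ι) := Cardinal.eq.1 <| by
      simp [Cardinal.add_eq_self (Cardinal.aleph0_le_mk ι)]
    let H : (ι → ℝ) ≃ₜ (ι → ℝ) × (ι → ℝ) :=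
      (Homeomorph.piCongrLeft (Y := fun _ => ℝ) e).symm.trans
        Homeomorph.sumArrowHomeomorphProdArrow
    have := (hA ⟨fun x => H.symm (f x, g x), by fun_prop⟩).image H.continuous
    rw [image_image] at this
    simpa using this

theorem CCompactIn.inter_preimage [Nonempty ι] (hA : CCompactIn ι A) (f : C(X, ι → ℝ))
    {Z : Set (ι → ℝ)} (hZ : IsClosed Z) : CCompactIn ι (A ∩ f ⁻¹' Z) := by
  intro g
  have := ((hA.isCompact_image_prod f g).inter_right (hZ.preimage continuous_fst)).image
    continuous_snd
  convert this using 1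
  ext y
  constructor
  · rintro ⟨x, ⟨hx, hz⟩, rfl⟩
    exact ⟨_, ⟨⟨x, hx, rfl⟩, hz⟩, rfl⟩
  · rintro ⟨_, ⟨⟨x, hx, rfl⟩, hz⟩, rfl⟩
    exact ⟨x, ⟨hx, hz⟩, rfl⟩

/-! ### The set-open topology as a topology of uniform convergence -/

theorem tendstoUniformlyOn_setOpenTopology [Nonempty ι] (hA : CCompactIn ι A)
    (hAΛ : A ∈ lambdaC ι Λ) (f : C(X, ι → ℝ)) :
    TendstoUniformlyOn (fun g : C(X, ι → ℝ) => ⇑g) f (@nhds _ (setOpenTopology ι Λ) f) A := by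
  let := setOpenTopology (X := X) ι Λ
  intro V hV
  obtain ⟨W, hW, hWo, hWs, hWV⟩ := comp_open_symm_mem_uniformity_sets hV
  obtain ⟨Z, hZ, hZc, hZW⟩ := mem_uniformity_isClosed hW
  obtain ⟨t, -, ht⟩ := (hA f).elim_nhds_subcover (fun p => UniformSpace.ball p Z)
    fun p _ => UniformSpace.ball_mem_nhds p hZ
  have key : ∀ p ∈ t, ∀ᶠ g : C(X, ι → ℝ) in 𝓝 f,
      MapsTo g (A ∩ f ⁻¹' UniformSpace.ball p Z) (UniformSpace.ball p W) := fun p _ =>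
    (hAΛ.2 _ inter_subset_left (hA.inter_preimage f (UniformSpace.isClosed_ball p hZc)) _
      (UniformSpace.isOpen_ball p hWo)).mem_nhds fun x hx => hZW hx.2
  filter_upwards [(Filter.eventually_all_finset t).2 key] with g hg x hx
  obtain ⟨p, hp, hxp⟩ := mem_iUnion₂.1 (ht ⟨x, hx, rfl⟩)
  exact hWV ⟨p, SetRel.symm W (hZW hxp), hg p hp ⟨hx, hxp⟩⟩

theorem continuous_setOpenTopology_of_tendstoUniformlyOn {S P : Type*} [TopologicalSpace S]
    [UniformSpace P] {m : P → ι → ℝ} (hm : Continuous m) {F : S → X → P}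
    (hF : ∀ s, ∀ A ∈ Λ, TendstoUniformlyOn F (F s) (𝓝 s) A)
    (hK : ∀ s, ∀ A ∈ Λ, ∃ K, IsCompact K ∧ MapsTo (F s) A K)
    (hc : ∀ A ∈ Λ, CCompactIn ι A)
    {Φ : S → C(X, ι → ℝ)} (hΦ : ∀ s x, Φ s x = m (F s x)) :
    Continuous[inferInstance, setOpenTopology ι Λ] Φ := by
  refine continuous_generateFrom_iff.2 ?_
  rintro _ ⟨A, hA, U, hU, rfl⟩
  refine isOpen_iff_mem_nhds.2 fun s hs => ?_
  obtain ⟨V, hV, -, hVU⟩ :=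
    lebesgue_number_of_compact_open (hc A hA (Φ s)) hU (image_subset_iff.2 hs)
  obtain ⟨K, hK, hKs⟩ := hK s A hA
  filter_upwards [hF s A hA _
    (hK.uniformContinuousAt_of_continuousAt m (fun _ _ => hm.continuousAt) hV)] with s' hs' x hx
  refine hVU _ ⟨x, hx, rfl⟩ ?_
  change (Φ s x, Φ s' x) ∈ V
  rw [hΦ, hΦ]
  exact hs' x hx (hKs hx)

theorem continuous_binop_setOpenTopology [Nonempty ι] (hc : ∀ A ∈ Λ, CCompactIn ι A)
    (hΛ : Λ = lambdaC ι Λ) {m : (ι → ℝ) × (ι → ℝ) → ι → ℝ} (hm : Continuous m)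
    {Φ : C(X, ι → ℝ) × C(X, ι → ℝ) → C(X, ι → ℝ)} (hΦ : ∀ p x, Φ p x = m (p.1 x, p.2 x)) :
    Continuous[@instTopologicalSpaceProd _ _ (setOpenTopology ι Λ) (setOpenTopology ι Λ),
      setOpenTopology ι Λ] Φ := by
  let := setOpenTopology (X := X) ι Λ
  refine continuous_setOpenTopology_of_tendstoUniformlyOn hm
    (F := fun p x => (p.1 x, p.2 x)) (fun p A hA => ?_) (fun p A hA => ?_) hc hΦ
  · have h (f : C(X, ι → ℝ)) := tendstoUniformlyOn_setOpenTopology (hc A hA) (hΛ ▸ hA) f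
    rw [nhds_prod_eq]
    exact (h p.1).prodMk (h p.2)
  · exact ⟨_, (hc A hA p.1).prod (hc A hA p.2), fun x hx => ⟨⟨x, hx, rfl⟩, ⟨x, hx, rfl⟩⟩⟩

theorem continuous_smul_setOpenTopology [Nonempty ι] (hc : ∀ A ∈ Λ, CCompactIn ι A)
    (hΛ : Λ = lambdaC ι Λ) :
    Continuous[@instTopologicalSpaceProd _ _ inferInstance (setOpenTopology ι Λ),
      setOpenTopology ι Λ] (fun p : ℝ × C(X, ι → ℝ) => p.1 • p.2) := by
  let := setOpenTopology (X := X) ι Λ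
  refine continuous_setOpenTopology_of_tendstoUniformlyOn
    (m := fun q : ℝ × (ι → ℝ) => q.1 • q.2) (by fun_prop)
    (F := fun p x => (p.1, p.2 x)) (fun p A hA => ?_) (fun p A hA => ?_) hc fun _ _ => rfl
  · have h := tendstoUniformlyOn_setOpenTopology (hc A hA) (hΛ ▸ hA) p.2
    have h' : TendstoUniformlyOn (fun (t : ℝ) (_ : X) => t) (fun _ => p.1) (𝓝 p.1) A :=
      fun V hV => Filter.mem_of_superset (mem_nhds_left p.1 hV) fun _ ht _ _ => ht
    rw [nhds_prod_eq]
    exact h'.prodMk h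
  · exact ⟨_, isCompact_singleton.prod (hc A hA p.2), fun x hx => ⟨rfl, ⟨x, hx, rfl⟩⟩⟩

/-! ### Consequences of continuity of the linear operations -/

theorem CCompactIn.of_continuous_add_smul (hΛ : ∀ A ∈ Λ, A.Nonempty)
    (hadd : Continuous[@instTopologicalSpaceProd _ _ (setOpenTopology ι Λ) (setOpenTopology ι Λ),
        setOpenTopology ι Λ] (fun p : C(X, ι → ℝ) × C(X, ι → ℝ) => p.1 + p.2))
    (hsmul : Continuous[@instTopologicalSpaceProd _ _ inferInstance (setOpenTopology ι Λ),
        setOpenTopology ι Λ] (fun p : ℝ × C(X, ι → ℝ) => p.1 • p.2))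
    (hA : A ∈ Λ) : CCompactIn ι A := by
  let := setOpenTopology (X := X) ι Λ
  intro f
  have hbdd (i : ι) : ∃ r, MapsTo (fun x => f x i) A (Metric.closedBall 0 r) := by
    have hcont : Continuous fun t : ℝ => t • f := hsmul.comp (by fun_prop : Continuous (·, f))
    have hU : IsOpen {y : ι → ℝ | |y i| < 1} := isOpen_lt (by fun_prop) continuous_const
    have hmem := ((isOpen_setOpenTopology hA hU).preimage hcont).mem_nhds
      (show (0 : ℝ) ∈ _ from fun x _ => by simp)
    obtain ⟨ε, hε, hball⟩ := Metric.mem_nhds_iff.1 hmem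
    refine ⟨(ε / 2)⁻¹, fun x hx => ?_⟩
    have h := hball (show ε / 2 ∈ Metric.ball (0 : ℝ) ε by
      rw [mem_ball_zero_iff, Real.norm_eq_abs, abs_of_pos] <;> linarith) hx
    have h' : ε / 2 * |f x i| < 1 := by
      simpa [abs_mul, abs_of_pos (half_pos hε)] using h
    rw [mem_closedBall_zero_iff, Real.norm_eq_abs, inv_eq_one_div, le_div_iff₀ (by positivity)]
    linarith
  choose r hr using hbdd
  refine (isCompact_univ_pi fun i => isCompact_closedBall (0 : ℝ) (r i)).of_isClosed_subset
    (isClosed_of_closure_subset fun p hp => ?_) (by rintro _ ⟨x, hx, rfl⟩ i -; exact hr i hx)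
  by_contra hpA
  have hcont : Continuous fun c : ι → ℝ => f + ContinuousMap.const X c :=
    hadd.comp (continuous_const.prodMk (continuous_const_setOpenTopology hΛ))
  have hmem := ((isOpen_setOpenTopology hA (isOpen_compl_singleton (x := p))).preimage
    hcont).mem_nhds (show (0 : ι → ℝ) ∈ _ from fun x hx hxp => hpA ⟨x, hx, by simpa using hxp⟩)
  have hsub : Tendsto (fun y => p - y) (𝓝 p) (𝓝 0) := by
    simpa using (show Continuous fun y => p - y by fun_prop).tendsto p
  obtain ⟨_, hy, x, hx, rfl⟩ := mem_closure_iff_nhds.1 hp _ (hsub hmem)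
  exact hy hx (by simp)

theorem isOpen_mapsTo_of_continuous_add
    (hadd : Continuous[@instTopologicalSpaceProd _ _ (setOpenTopology ι Λ) (setOpenTopology ι Λ),
        setOpenTopology ι Λ] (fun p : C(X, ι → ℝ) × C(X, ι → ℝ) => p.1 + p.2))
    (hA : A ∈ Λ) (hBA : B ⊆ A) (hB : CCompactIn ι B) {U : Set (ι → ℝ)} (hU : IsOpen U) :
    IsOpen[setOpenTopology ι Λ] {f : C(X, ι → ℝ) | MapsTo f B U} := by
  let := setOpenTopology (X := X) ι Λ
  refine isOpen_iff_mem_nhds.2 fun f hf => ?_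
  obtain ⟨V, hV, hVU⟩ := compact_open_separated_add_right (hB f) hU (image_subset_iff.2 hf)
  obtain ⟨N, hNV, hN, hN0⟩ := mem_nhds_iff.1 hV
  have hcont : Continuous fun g : C(X, ι → ℝ) => g + -f :=
    hadd.comp (by fun_prop : Continuous (·, -f))
  have hmem := ((isOpen_setOpenTopology hA hN).preimage hcont).mem_nhds
    (show f ∈ _ from fun x _ => by simpa using hN0)
  filter_upwards [hmem] with g hg x hx
  have := hVU (add_mem_add ⟨x, hx, rfl⟩ (hNV (hg (hBA hx))))
  simpa using this

end

theorem statement_7 {X : Type*} [TopologicalSpace X] [T35Space X]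
    (ι : Type*) [Nonempty ι] (Λ : Set (Set X)) (hΛ : ∀ A ∈ Λ, A.Nonempty) :
    (Continuous[@instTopologicalSpaceProd _ _ (setOpenTopology ι Λ) (setOpenTopology ι Λ),
        setOpenTopology ι Λ]
        (fun p : C(X, ι → ℝ) × C(X, ι → ℝ) => p.1 + p.2) ∧
      Continuous[@instTopologicalSpaceProd _ _ inferInstance (setOpenTopology ι Λ),
        setOpenTopology ι Λ]
        (fun p : ℝ × C(X, ι → ℝ) => p.1 • p.2) ∧
      Continuous[@instTopologicalSpaceProd _ _ (setOpenTopology ι Λ) (setOpenTopology ι Λ),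
        setOpenTopology ι Λ]
        (fun p : C(X, ι → ℝ) × C(X, ι → ℝ) => p.1 * p.2)) ↔
    (∀ A ∈ Λ, CCompactIn ι A) ∧ Λ = lambdaC ι Λ := by
  constructor
  · rintro ⟨hadd, hsmul, -⟩
    refine ⟨fun A hA => .of_continuous_add_smul hΛ hadd hsmul hA,
      Subset.antisymm ?_ fun A hA => hA.1⟩
    exact fun A hA => ⟨hA, fun B hBA hB U hU => isOpen_mapsTo_of_continuous_add hadd hA hBA hB hU⟩
  · rintro ⟨hc, hΛc⟩
    exact ⟨continuous_binop_setOpenTopology hc hΛc continuous_add fun _ _ => rfl,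
      continuous_smul_setOpenTopology hc hΛc,
      continuous_binop_setOpenTopology hc hΛc continuous_mul fun _ _ => rfl⟩
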